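/- arXiv:1701.07570 — 2 statements merged into one kernel-verified Lean document; each statement's English description precedes it below -/
import Mathlib

section
/- For any comparator sequence u_1, …, u_T ∈ Ω and every partition of {1,…,T} into consecutive intervals I_1=[s_1,q_1], …, I_k=[s_k,q_k], the dynamic regret satisfies Σ_{t=1}^T f_t(w_t) − Σ_{t=1}^T f_t(u_t) ≤ Σ_{i=1}^k ( SAReg(T, |I_i|) + 2·|I_i|·V(s_i, q_i) ). -/
/-- Local functional variation of `f` over the interval `[s, q]`:
`V(s,q) = ∑_{t=s+1}^{q} max_{w ∈ Ω} |f_t(w) − f_{t−1}(w)|`. -/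
noncomputable def locVar {E : Type*} [NormedAddCommGroup E] [NormedSpace ℝ E]
    (Ω : Set E) (f : ℕ → E → ℝ) (s q : ℕ) : ℝ :=
  ∑ t ∈ Finset.Icc (s + 1) q, sSup ((fun x => |f t x - f (t - 1) x|) '' Ω)

/-- Static regret of the decisions `w` over the interval `[s, q]`. -/
noncomputable def statReg {E : Type*} [NormedAddCommGroup E] [NormedSpace ℝ E]
    (Ω : Set E) (f : ℕ → E → ℝ) (w : ℕ → E) (s q : ℕ) : ℝ :=
  (∑ t ∈ Finset.Icc s q, f t (w t)) - sInf ((fun x => ∑ t ∈ Finset.Icc s q, f t x) '' Ω)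

/-- Strongly adaptive regret at scale `τ`: the maximum of the static regret over all
intervals `[s, s+τ−1] ⊆ [1, T]`. -/
noncomputable def SAReg {E : Type*} [NormedAddCommGroup E] [NormedSpace ℝ E]
    (Ω : Set E) (f : ℕ → E → ℝ) (w : ℕ → E) (T τ : ℕ) : ℝ :=
  sSup ((fun s => statReg Ω f w s (s + τ - 1)) '' Set.Icc 1 (T - τ + 1))

/-- Worst-case dynamic regret over `T` rounds. -/
noncomputable def DRegStar {E : Type*} [NormedAddCommGroup E] [NormedSpace ℝ E]
    (Ω : Set E) (f : ℕ → E → ℝ) (w : ℕ → E) (T : ℕ) : ℝ :=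
  (∑ t ∈ Finset.Icc 1 T, f t (w t)) - ∑ t ∈ Finset.Icc 1 T, sInf ((f t) '' Ω)

lemma abs_sub_le_locVar
    {E : Type*} [NormedAddCommGroup E] [NormedSpace ℝ E]
    (T : ℕ) (Ω : Set E) (hΩ : IsCompact Ω)
    (f : ℕ → E → ℝ) (hf : ∀ t ∈ Finset.Icc 1 T, ContinuousOn (f t) Ω)
    (s : ℕ) (hs : 1 ≤ s) (x : E) (hx : x ∈ Ω) (t : ℕ) (hst : s ≤ t) (htT : t ≤ T) :
    |f t x - f s x| ≤ locVar Ω f s t := by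
  induction t, hst using Nat.le_induction with
  | base => simp [locVar]
  | succ t hst ih =>
    have ih := ih (by omega)
    have h1 : locVar Ω f s (t + 1) = locVar Ω f s t +
        sSup ((fun x => |f (t + 1) x - f t x|) '' Ω) := by
      unfold locVar
      rw [Finset.sum_Icc_succ_top (by omega)]
      simp
    have h2 : |f (t + 1) x - f t x| ≤ sSup ((fun x => |f (t + 1) x - f t x|) '' Ω) := by
      apply le_csSup
      · apply hΩ.bddAbove_image
        exact ((hf _ (by simp; omega)).sub (hf _ (by simp; omega))).abs
      · exact ⟨x, hx, rfl⟩
    have h3 := abs_sub_le (f (t + 1) x) (f t x) (f s x)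
    linarith

lemma locVar_mono
    {E : Type*} [NormedAddCommGroup E] [NormedSpace ℝ E]
    (Ω : Set E) (f : ℕ → E → ℝ) (s t q : ℕ) (h : t ≤ q) :
    locVar Ω f s t ≤ locVar Ω f s q := by
  unfold locVar
  apply Finset.sum_le_sum_of_subset_of_nonneg
  · exact Finset.Icc_subset_Icc_right h
  · intro i _ _
    apply Real.sSup_nonneg
    rintro _ ⟨x, _, rfl⟩
    exact abs_nonneg _

lemma interval_regret
    {E : Type*} [NormedAddCommGroup E] [NormedSpace ℝ E]
    (T : ℕ) (Ω : Set E) (hΩne : Ω.Nonempty) (hΩ : IsCompact Ω)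
    (f : ℕ → E → ℝ) (hf : ∀ t ∈ Finset.Icc 1 T, ContinuousOn (f t) Ω)
    (w u : ℕ → E) (hu : ∀ t ∈ Finset.Icc 1 T, u t ∈ Ω)
    (s q : ℕ) (hs : 1 ≤ s) (hsq : s ≤ q) (hq : q ≤ T) :
    ∑ t ∈ Finset.Icc s q, (f t (w t) - f t (u t)) ≤
      SAReg Ω f w T (q - s + 1) + 2 * ((q - s + 1 : ℕ) : ℝ) * locVar Ω f s q := by
  obtain ⟨v, hv, hmin⟩ := hΩ.exists_isMinOn hΩne (hf s (by simp; omega))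
  have hsa : statReg Ω f w s q ≤ SAReg Ω f w T (q - s + 1) := by
    apply le_csSup
    · exact ((Set.finite_Icc _ _).image _).bddAbove
    · refine ⟨s, ⟨hs, by omega⟩, ?_⟩
      have : s + (q - s + 1) - 1 = q := by omega
      simp only [this]
  have hinf : sInf ((fun x => ∑ t ∈ Finset.Icc s q, f t x) '' Ω) ≤
      ∑ t ∈ Finset.Icc s q, f t v := by
    apply csInf_le
    · apply hΩ.bddBelow_image
      apply continuousOn_finsetSum
      intro t ht
      rw [Finset.mem_Icc] at ht
      exact hf t (by simp; omega)
    · exact ⟨v, hv, rfl⟩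
  have hpt : ∑ t ∈ Finset.Icc s q, (f t v - f t (u t)) ≤
      ∑ t ∈ Finset.Icc s q, 2 * locVar Ω f s q := by
    apply Finset.sum_le_sum
    intro t ht
    rw [Finset.mem_Icc] at ht
    have hut := hu t (by simp; omega)
    have h1 := abs_le.1 (abs_sub_le_locVar T Ω hΩ f hf s hs v hv t ht.1 (by omega))
    have h2 := abs_le.1 (abs_sub_le_locVar T Ω hΩ f hf s hs (u t) hut t ht.1 (by omega))
    have h3 := locVar_mono Ω f s t q ht.2
    have h4 : f s v ≤ f s (u t) := hmin hut
    linarith [h1.2, h2.1]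
  rw [Finset.sum_const, Nat.card_Icc, nsmul_eq_mul,
    show q + 1 - s = q - s + 1 by omega] at hpt
  rw [Finset.sum_sub_distrib] at hpt ⊢
  unfold statReg at hsa
  linarith

lemma partition_sum (g : ℕ → ℝ) (k : ℕ) (s q : ℕ → ℕ) (hs1 : s 1 = 1)
    (hcons : ∀ i ∈ Finset.Icc 1 (k - 1), q i + 1 = s (i + 1))
    (hle : ∀ i ∈ Finset.Icc 1 k, s i ≤ q i) (j : ℕ) (hj : 1 ≤ j) (hjk : j ≤ k) :
    (∑ t ∈ Finset.Icc 1 (q j), g t =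
      ∑ i ∈ Finset.Icc 1 j, ∑ t ∈ Finset.Icc (s i) (q i), g t) ∧
    ∀ i ∈ Finset.Icc 1 j, 1 ≤ s i ∧ q i ≤ q j := by
  induction j, hj using Nat.le_induction with
  | base =>
    constructor
    · simp [hs1]
    · intro i hi
      obtain rfl : i = 1 := by simpa using hi
      simp [hs1]
  | succ j hj ih =>
    obtain ⟨h1, h2⟩ := ih (by omega)
    have hc := hcons j (by simp; omega)
    have hl := hle (j + 1) (by simp; omega)
    constructor
    · rw [Finset.sum_Icc_succ_top (by omega), ← h1, ← hc]
      have hI : ∀ a b : ℕ, Finset.Icc a b = Finset.Ico a (b + 1) := by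
        intro a b; ext x; rw [Finset.mem_Icc, Finset.mem_Ico]; omega
      simp only [hI]
      exact (Finset.sum_Ico_consecutive g (by omega) (by omega)).symm
    · intro i hi
      rw [Finset.mem_Icc] at hi
      rcases Nat.lt_or_ge j i with h | h
      · obtain rfl : i = j + 1 := by omega
        omega
      · have := h2 i (by simp; omega)
        omega

/-- For any comparator sequence `u_1, …, u_T ∈ Ω` and every partition of `[1,T]` into
consecutive intervals `I_i = [s_i, q_i]`, the dynamic regret against `u` is bounded by
`∑_i ( SAReg(T, |I_i|) + 2 |I_i| V(s_i, q_i) )`. -/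
theorem dynamic_regret_comparator_le_adaptive_regret
    {E : Type*} [NormedAddCommGroup E] [NormedSpace ℝ E]
    (T : ℕ) (hT : 1 ≤ T) (Ω : Set E) (hΩne : Ω.Nonempty) (hΩ : IsCompact Ω)
    (f : ℕ → E → ℝ) (hf : ∀ t ∈ Finset.Icc 1 T, ContinuousOn (f t) Ω)
    (w : ℕ → E) (hw : ∀ t ∈ Finset.Icc 1 T, w t ∈ Ω)
    (u : ℕ → E) (hu : ∀ t ∈ Finset.Icc 1 T, u t ∈ Ω)
    (k : ℕ) (hk : 1 ≤ k) (s q : ℕ → ℕ)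
    (hs1 : s 1 = 1) (hqk : q k = T)
    (hcons : ∀ i ∈ Finset.Icc 1 (k - 1), q i + 1 = s (i + 1))
    (hle : ∀ i ∈ Finset.Icc 1 k, s i ≤ q i) :
    (∑ t ∈ Finset.Icc 1 T, f t (w t)) - ∑ t ∈ Finset.Icc 1 T, f t (u t) ≤
      ∑ i ∈ Finset.Icc 1 k,
        (SAReg Ω f w T (q i - s i + 1) +
          2 * ((q i - s i + 1 : ℕ) : ℝ) * locVar Ω f (s i) (q i)) := by
  have hP := partition_sum (fun t => f t (w t) - f t (u t)) k s q hs1 hcons hle k hk le_rfl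
  rw [← Finset.sum_sub_distrib]
  rw [hqk] at hP
  rw [hP.1]
  apply Finset.sum_le_sum
  intro i hi
  exact interval_regret T Ω hΩne hΩ f hf w u hu (s i) (q i) (hP.2 i hi).1 (hle i hi) (hP.2 i hi).2
end

section
/- For every integer K ≥ 2 and every integer t ≥ 1, the cardinality of {j : 1 ≤ j ≤ t and t < E_K(j)} is at most the sum of the digits of t in its base-K representation. -/
/-- `kOfExp K t` is the largest `k` such that `K^k` divides `t` (for `K ≥ 2`, `t ≥ 1`). -/
def kOfExp (K t : ℕ) : ℕ := Nat.findGreatest (fun k => K ^ k ∣ t) t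

/-- The base-`K` ending time: set the lowest nonzero base-`K` digit of `t` to `0` and
add `1` to the digit one position higher, i.e.
`E_K(t) = K^(k(t)+1) · (⌊t / K^(k(t)+1)⌋ + 1)`. -/
def endK (K t : ℕ) : ℕ := K ^ (kOfExp K t + 1) * (t / K ^ (kOfExp K t + 1) + 1)

theorem kOfExp_dvd (K t : ℕ) : K ^ kOfExp K t ∣ t := by
  unfold kOfExp
  exact Nat.findGreatest_spec (P := fun k => K ^ k ∣ t) (Nat.zero_le t) (by simp)

theorem le_kOfExp (K t k : ℕ) (hK : 2 ≤ K) (ht : 1 ≤ t) (h : K ^ k ∣ t) : k ≤ kOfExp K t := by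
  unfold kOfExp
  refine Nat.le_findGreatest ?_ h
  have h1 : K ^ k ≤ t := Nat.le_of_dvd ht h
  have h2 : k < K ^ k := Nat.lt_pow_self (by omega)
  omega

theorem kOfExp_mul (K j : ℕ) (hK : 2 ≤ K) (hj : 1 ≤ j) : kOfExp K (K * j) = kOfExp K j + 1 := by
  have hp : 1 ≤ K * j := Nat.mul_pos (by omega) hj
  apply le_antisymm
  · have h := kOfExp_dvd K (K * j)
    rcases hk : kOfExp K (K * j) with _ | m
    · omega
    · rw [hk, pow_succ'] at h
      have := le_kOfExp K j m hK hj (Nat.dvd_of_mul_dvd_mul_left (by omega) h)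
      omega
  · apply le_kOfExp K _ _ hK hp
    rw [pow_succ']
    exact Nat.mul_dvd_mul_left K (kOfExp_dvd K j)

theorem endK_mul (K j : ℕ) (hK : 2 ≤ K) (hj : 1 ≤ j) : endK K (K * j) = K * endK K j := by
  unfold endK
  rw [kOfExp_mul K j hK hj, pow_succ' K (kOfExp K j + 1),
    Nat.mul_div_mul_left _ _ (by omega : 0 < K), mul_assoc]

theorem endK_not_dvd (K j : ℕ) (h : ¬ K ∣ j) : endK K j = K * (j / K + 1) := by
  have h0 : kOfExp K j = 0 := by
    by_contra hne
    exact h ((dvd_pow_self K hne).trans (kOfExp_dvd K j))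
  simp [endK, h0]

theorem card_alive_aux (K : ℕ) (hK : 2 ≤ K) (t : ℕ) :
    ((Finset.Icc 1 t).filter fun j => t < endK K j).card ≤ (Nat.digits K t).sum := by
  induction t using Nat.strong_induction_on with
  | _ t ih =>
  rcases Nat.eq_zero_or_pos t with rfl | ht
  · simp
  rw [Nat.digits_def' (by omega) ht, List.sum_cons]
  have hsub : ((Finset.Icc 1 t).filter fun j => t < endK K j) ⊆
      Finset.Ioc (K * (t / K)) t ∪
        ((Finset.Icc 1 (t / K)).filter fun j => t / K < endK K j).image (fun j => K * j) := by
    intro j hj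
    rw [Finset.mem_filter, Finset.mem_Icc] at hj
    obtain ⟨⟨h1, h2⟩, h3⟩ := hj
    rw [Finset.mem_union]
    by_cases hd : K ∣ j
    · right
      obtain ⟨c, rfl⟩ := hd
      have hc : 1 ≤ c := Nat.pos_of_mul_pos_left h1
      rw [endK_mul K c hK hc] at h3
      refine Finset.mem_image.2 ⟨c, Finset.mem_filter.2 ⟨Finset.mem_Icc.2 ⟨hc, ?_⟩, ?_⟩, rfl⟩
      · rw [Nat.le_div_iff_mul_le (by omega), mul_comm]; exact h2
      · rw [Nat.div_lt_iff_lt_mul (by omega), mul_comm]; exact h3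
    · left
      rw [endK_not_dvd K j hd] at h3
      have h4 : t / K < j / K + 1 := by
        rw [Nat.div_lt_iff_lt_mul (by omega), mul_comm]; exact h3
      have h5 : K * (t / K) ≤ K * (j / K) := Nat.mul_le_mul_left K (by omega)
      have h6 := Nat.mul_div_le j K
      have h7 : K * (t / K) ≠ j := fun h => hd ⟨_, h.symm⟩
      rw [Finset.mem_Ioc]
      omega
  refine (Finset.card_le_card hsub).trans ((Finset.card_union_le _ _).trans ?_)
  refine Nat.add_le_add ?_ (Finset.card_image_le.trans (ih _ (Nat.div_lt_self ht (by omega))))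
  rw [Nat.card_Ioc]
  have := Nat.div_add_mod t K
  omega

/-- The number of indices `j ∈ [1,t]` alive at time `t` (i.e. with `t < E_K(j)`) is at
most the sum of the base-`K` digits of `t`. -/
theorem card_alive_le_digit_sum (K t : ℕ) (hK : 2 ≤ K) (ht : 1 ≤ t) :
    ((Finset.Icc 1 t).filter fun j => t < endK K j).card ≤ (Nat.digits K t).sum := by
  exact card_alive_aux K hK t
end
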